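/- Let m ≥ 3. Let the symmetric group S_m act on sets R of permutations of [m] by σ·R = {(σ(i_1)⋯σ(i_m)) : (i_1⋯i_m) ∈ R}, and call two ranking patterns equivalent if one is obtained from the other by this action. Then the number of equivalence classes of the set {RP^UF(μ_1,…,μ_m) : μ_1,…,μ_m ∈ ℝ^{m−2} generic} equals the number of equivalence classes of the set {RP(v) : v ∈ V} minus 1. -/

import Mathlib

open scoped BigOperators

/-- The chamber `C_{i₁⋯i_m}` of the braid arrangement restricted to
`H0 = {x : ∑ᵢ xᵢ = 0}`, associated with the permutation `σ` (where `σ k` is the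
object ranked in position `k`). -/
def braidChamber {m : ℕ} (σ : Equiv.Perm (Fin m)) :
    Set (EuclideanSpace ℝ (Fin m)) :=
  {x | (∑ i, x i = 0) ∧ ∀ k l : Fin m, k < l → x (σ l) < x (σ k)}

/-- The slicing hyperplane `K_v = {x ∈ H0 : vᵀ x = 1}`. -/
def sliceK {m : ℕ} (v : EuclideanSpace ℝ (Fin m)) :
    Set (EuclideanSpace ℝ (Fin m)) :=
  {x | (∑ i, x i = 0) ∧ ∑ i, v i * x i = 1}

/-- The set `V` of generic unit directions: `v ∈ H0`, `‖v‖ = 1`, and all sums of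
entries of `v` over nonempty proper subsets of `[m]` are nonzero. -/
def genericDirections (m : ℕ) : Set (EuclideanSpace ℝ (Fin m)) :=
  {v | (∑ i, v i = 0) ∧ ‖v‖ = 1 ∧
    ∀ I : Finset (Fin m), I.Nonempty → I ≠ Finset.univ → ∑ i ∈ I, v i ≠ 0}

/-- Condition (A) for `m` points in a real vector space, with `N` edges. -/
def ConditionA {m : ℕ} (N : ℕ) {E : Type*} [AddCommGroup E] [Module ℝ E]
    (ν : Fin m → E) : Prop :=
  ∀ e : Fin N → Fin m × Fin m,
    (∀ k, (e k).1 ≠ (e k).2) →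
    Function.Injective (fun k => s((e k).1, (e k).2)) →
    ((SimpleGraph.fromEdgeSet
        (Set.range fun k => s((e k).1, (e k).2))).IsAcyclic ↔
      LinearIndependent ℝ fun k => ν (e k).1 - ν (e k).2)

/-- Genericity of `μ₁,…,μ_m ∈ ℝ^{m-2}` : condition (A1) and condition (A2) for
the lifted points `(μⱼ, ‖μⱼ‖²)`. -/
def Generic {m : ℕ} (μ : Fin m → EuclideanSpace ℝ (Fin (m - 2))) : Prop :=
  ConditionA (m - 2) μ ∧
    ConditionA (m - 1)
      (fun j => (μ j, ‖μ j‖ ^ 2) :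
        Fin m → EuclideanSpace ℝ (Fin (m - 2)) × ℝ)

/-- The ranking pattern of the braid slice by `K_v`. -/
def rankingPattern {m : ℕ} (v : EuclideanSpace ℝ (Fin m)) :
    Set (Equiv.Perm (Fin m)) :=
  {σ | (sliceK v ∩ braidChamber σ).Nonempty}

/-- The ranking pattern of the unfolding model with ideal objects `μ₁,…,μ_m`. -/
def rankingPatternUF {m n : ℕ} (μ : Fin m → EuclideanSpace ℝ (Fin n)) :
    Set (Equiv.Perm (Fin m)) :=
  {σ | ∃ y : EuclideanSpace ℝ (Fin n),
    ∀ k l : Fin m, k < l → ‖y - μ (σ k)‖ < ‖y - μ (σ l)‖}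

/-- Two ranking patterns are equivalent iff one is obtained from the other by
relabelling the objects: `σ·R = {(σ(i₁)⋯σ(i_m)) : (i₁⋯i_m) ∈ R}`. -/
def patternEquiv {m : ℕ} (R R' : Set (Equiv.Perm (Fin m))) : Prop :=
  ∃ σ : Equiv.Perm (Fin m), R = (fun τ => σ * τ) '' R'

/-- The set of ranking patterns of unfolding models of codimension one. -/
def rankingPatternsUF (m : ℕ) : Set (Set (Equiv.Perm (Fin m))) :=
  {R | ∃ μ : Fin m → EuclideanSpace ℝ (Fin (m - 2)),
    Generic μ ∧ R = rankingPatternUF μ}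

/-- The set of ranking patterns of generic braid slices. -/
def rankingPatternsSlices (m : ℕ) : Set (Set (Equiv.Perm (Fin m))) :=
  {R | ∃ v ∈ genericDirections m, R = rankingPattern v}

section Graph

variable {V ι E : Type*} [AddCommGroup E] [Module ℝ E]

theorem isAcyclic_of_linearIndependent_sub (e : ι → V × V) (ν : V → E)
    (h : LinearIndependent ℝ fun k => ν (e k).1 - ν (e k).2) :
    (SimpleGraph.fromEdgeSet (Set.range fun k => s((e k).1, (e k).2))).IsAcyclic := by
  rw [SimpleGraph.isAcyclic_iff_forall_isBridge]
  intro q hq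
  rw [SimpleGraph.edgeSet_fromEdgeSet] at hq
  obtain ⟨⟨k, rfl⟩, -⟩ := hq
  rw [SimpleGraph.isBridge_iff]
  intro hr
  refine linearIndependent_iff_notMem_span.1 h k ?_
  rw [SimpleGraph.reachable_iff_reflTransGen] at hr
  suffices H : ∀ b, Relation.ReflTransGen (SimpleGraph.deleteEdges _ _).Adj (e k).1 b →
      ν (e k).1 - ν b ∈
        Submodule.span ℝ ((fun k => ν (e k).1 - ν (e k).2) '' (Set.univ \ {k})) from H _ hr
  intro b hb
  induction hb with
  | refl => simp
  | @tail b c _ hbc ih =>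
    rw [SimpleGraph.deleteEdges_adj, SimpleGraph.fromEdgeSet_adj] at hbc
    obtain ⟨⟨⟨l, hl⟩, -⟩, hne⟩ := hbc
    have hlk : l ≠ k := by
      rintro rfl
      exact hne (by simpa using hl.symm)
    have hmem : ν (e l).1 - ν (e l).2 ∈
        Submodule.span ℝ ((fun k => ν (e k).1 - ν (e k).2) '' (Set.univ \ {k})) :=
      Submodule.subset_span ⟨l, ⟨trivial, hlk⟩, rfl⟩
    have hsplit : ν (e k).1 - ν c = (ν (e k).1 - ν b) + (ν b - ν c) := by abel
    rw [hsplit]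
    refine add_mem ih ?_
    rcases Sym2.eq_iff.1 hl with ⟨h1, h2⟩ | ⟨h1, h2⟩
    · rw [← h1, ← h2]; exact hmem
    · rw [← h1, ← h2, ← neg_sub]; exact neg_mem hmem

variable [Fintype V] [DecidableEq V] [Fintype ι]

theorem sum_filter_sub_smul_eq_zero (e : ι → V × V) (c : ι → ℝ) (p : V → Prop) [DecidablePred p]
    (h : ∀ k, c k ≠ 0 → (p (e k).1 ↔ p (e k).2)) :
    ∑ i with p i, (∑ k, c k • (Pi.single (e k).1 1 - Pi.single (e k).2 1 : V → ℝ)) i = 0 := by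
  simp only [Finset.sum_apply]
  rw [Finset.sum_comm]
  refine Finset.sum_eq_zero fun k _ => ?_
  by_cases hc : c k = 0
  · simp [hc]
  · have := h k hc
    simp [← Finset.mul_sum, Finset.sum_sub_distrib, Pi.single_apply, Finset.sum_ite_eq', this]

theorem linearIndependent_single_sub_single (e : ι → V × V) (hne : ∀ k, (e k).1 ≠ (e k).2)
    (hinj : Function.Injective fun k => s((e k).1, (e k).2))
    (hG : (SimpleGraph.fromEdgeSet (Set.range fun k => s((e k).1, (e k).2))).IsAcyclic) :
    LinearIndependent ℝ fun k => (Pi.single (e k).1 1 - Pi.single (e k).2 1 : V → ℝ) := by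
  classical
  rw [Fintype.linearIndependent_iff]
  intro c hc k
  have hk : s((e k).1, (e k).2) ∈
      (SimpleGraph.fromEdgeSet (Set.range fun k => s((e k).1, (e k).2))).edgeSet := by
    rw [SimpleGraph.edgeSet_fromEdgeSet]
    exact ⟨⟨k, rfl⟩, by simpa using hne k⟩
  have hb := SimpleGraph.isAcyclic_iff_forall_isBridge.1 hG hk
  rw [SimpleGraph.isBridge_iff] at hb
  set G' := (SimpleGraph.fromEdgeSet (Set.range fun k => s((e k).1, (e k).2))).deleteEdges
    {s((e k).1, (e k).2)} with hG'
  have h0 := sum_filter_sub_smul_eq_zero e (Function.update c k 0)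
    (fun i => G'.Reachable (e k).1 i) (by
      intro l hl
      have hlk : l ≠ k := by rintro rfl; simp at hl
      have hadj : G'.Adj (e l).1 (e l).2 := by
        rw [hG', SimpleGraph.deleteEdges_adj, SimpleGraph.fromEdgeSet_adj]
        exact ⟨⟨⟨l, rfl⟩, hne l⟩, fun h => hlk (hinj h)⟩
      exact ⟨fun h => h.trans hadj.reachable, fun h => h.trans hadj.symm.reachable⟩)
  have hsplit : ∑ l, Function.update c k 0 l • (Pi.single (e l).1 1 - Pi.single (e l).2 1 : V → ℝ)
      = - (c k • (Pi.single (e k).1 1 - Pi.single (e k).2 1 : V → ℝ)) := by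
    rw [eq_neg_iff_add_eq_zero, ← hc, ← Finset.sum_erase_add _ _ (Finset.mem_univ k),
      ← Finset.sum_erase_add (a := k) _ (fun l => c l • _) (Finset.mem_univ k)]
    simp only [Function.update_self, zero_smul, add_zero]
    congr 1
    refine Finset.sum_congr rfl fun l hl => ?_
    rw [Function.update_of_ne (Finset.ne_of_mem_erase hl)]
  rw [hsplit] at h0
  simpa [← Finset.mul_sum, Finset.sum_sub_distrib, Pi.single_apply, Finset.sum_ite_eq', hb] using h0

theorem exists_not_reachable_of_card_lt [Nonempty V] (e : ι → V × V)
    (h : Fintype.card ι + 1 < Fintype.card V) :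
    ∃ a b, ¬ (SimpleGraph.fromEdgeSet (Set.range fun k => s((e k).1, (e k).2))).Reachable a b := by
  by_contra! hcon
  have hc := (SimpleGraph.Connected.mk hcon).card_vert_le_card_edgeSet_add_one
  have hle : Nat.card (SimpleGraph.fromEdgeSet
      (Set.range fun k => s((e k).1, (e k).2))).edgeSet ≤ Nat.card ι := by
    rw [SimpleGraph.edgeSet_fromEdgeSet]
    refine (Nat.card_mono (Set.finite_range _) Set.sdiff_subset).trans ?_
    exact Finite.card_range_le _
  simp only [Nat.card_eq_fintype_card] at hc hle
  omega

/-- Weighted sums of edge differences, rewritten as weighted sums of points. -/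
theorem sum_smul_sub_eq_sum_smul (e : ι → V × V) (c : ι → ℝ) (ν : V → E) :
    ∑ k, c k • (ν (e k).1 - ν (e k).2) =
      ∑ i, (∑ k, c k • (Pi.single (e k).1 1 - Pi.single (e k).2 1 : V → ℝ)) i • ν i := by
  simp only [Finset.sum_apply, Finset.sum_smul]
  rw [Finset.sum_comm]
  refine Finset.sum_congr rfl fun k _ => ?_
  simp [mul_smul, ← Finset.smul_sum, sub_smul, Finset.sum_sub_distrib, Pi.single_apply, ite_smul]

end Graph

section Genericity

variable {m N : ℕ} {E : Type*} [AddCommGroup E] [Module ℝ E]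

/-- The coefficients `w` form an affine dependence of the points `ν`. -/
def IsAffineDependence {V : Type*} [Fintype V] (ν : V → E) (w : V → ℝ) : Prop :=
  ∑ i, w i = 0 ∧ ∑ i, w i • ν i = 0

theorem conditionA_of_forall_eq_zero {ν : Fin m → E}
    (h : ∀ (e : Fin N → Fin m × Fin m) (c : Fin N → ℝ),
      IsAffineDependence ν
        (∑ k, c k • (Pi.single (e k).1 1 - Pi.single (e k).2 1 : Fin m → ℝ)) →
      ∑ k, c k • (Pi.single (e k).1 1 - Pi.single (e k).2 1 : Fin m → ℝ) = 0) :
    ConditionA N ν := by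
  intro e hne hinj
  refine ⟨fun hG => ?_, isAcyclic_of_linearIndependent_sub e ν⟩
  rw [Fintype.linearIndependent_iff]
  intro c hc
  rw [sum_smul_sub_eq_sum_smul] at hc
  refine Fintype.linearIndependent_iff.1 (linearIndependent_single_sub_single e hne hinj hG) c
    (h e c ⟨?_, hc⟩)
  simpa using sum_filter_sub_smul_eq_zero e c (fun _ => True) (fun _ _ => Iff.rfl)

/-- Under condition (A), the stars joining the fibres of `r` to their centres are linearly
independent. -/
theorem ConditionA.eq_zero_of_fiberwise {ν : Fin m → E} (h : ConditionA N ν) (r : Fin m → Fin m)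
    (hr : ∀ c, r (r c) = r c) (hcard : Fintype.card {c // r c ≠ c} = N) (w : Fin m → ℝ)
    (hfib : ∀ i, ∑ c with r c = i, w c = 0) (hw : ∑ c, w c • ν c = 0) : w = 0 := by
  obtain ⟨f⟩ : Nonempty (Fin N ≃ {c // r c ≠ c}) := ⟨(Fintype.equivFinOfCardEq hcard).symm⟩
  let e : Fin N → Fin m × Fin m := fun k => ((f k).1, r (f k).1)
  have hne : ∀ k, (e k).1 ≠ (e k).2 := fun k => (f k).2.symm
  have hinj : Function.Injective fun k => s((e k).1, (e k).2) := by
    intro k l hkl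
    apply f.injective
    rcases Sym2.eq_iff.1 hkl with ⟨h1, -⟩ | ⟨h1, h2⟩
    · exact Subtype.ext h1
    · refine absurd ?_ (f k).2
      change (f k).1 = r (f l).1 at h1
      rw [h1, hr]
  have hind : LinearIndependent ℝ
      fun k => (Pi.single (e k).1 1 - Pi.single (e k).2 1 : Fin m → ℝ) := by
    rw [Fintype.linearIndependent_iff]
    intro c hc k
    have := congrFun hc (e k).1
    rw [Finset.sum_apply, Finset.sum_eq_single k] at this
    · simpa [Pi.single_apply, hne k] using this
    · intro l _ hlk
      have h1 : (e k).1 ≠ (e l).1 := fun h => hlk (f.injective (Subtype.ext h)).symm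
      have h2 : (e k).1 ≠ (e l).2 := by
        intro h
        refine absurd ?_ (f k).2
        change (f k).1 = r (f l).1 at h
        rw [h, hr]
      simp [h1, h2]
    · simp
  have hlin := (h e hne hinj).1
    (isAcyclic_of_linearIndependent_sub e (fun i => Pi.single i (1 : ℝ)) hind)
  have hmove : ∑ c, w c • ν (r c) = 0 := by
    rw [← Finset.sum_fiberwise Finset.univ r]
    refine Finset.sum_eq_zero fun i _ => ?_
    rw [← zero_smul ℝ (ν i), ← hfib i, Finset.sum_smul]
    refine Finset.sum_congr rfl fun c hc => ?_
    rw [(Finset.mem_filter.1 hc).2]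
  have hsum : ∑ c, w c • (ν c - ν (r c)) = 0 := by
    simp only [smul_sub, Finset.sum_sub_distrib, hw, hmove, sub_zero]
  have hleaf : ∀ c, r c ≠ c → w c = 0 := by
    have hedges : ∑ k, w (f k).1 • (ν (e k).1 - ν (e k).2) = 0 := by
      rw [← hsum, Equiv.sum_comp f (fun c => w c.1 • (ν c.1 - ν (r c.1))),
        ← Finset.sum_subtype (Finset.univ.filter fun c => r c ≠ c) (by simp)
          (fun c => w c • (ν c - ν (r c)))]
      refine Finset.sum_filter_of_ne fun c _ hc hrc => hc ?_
      rw [hrc, sub_self, smul_zero]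
    intro c hc
    simpa using Fintype.linearIndependent_iff.1 hlin (fun k => w (f k).1) hedges (f.symm ⟨c, hc⟩)
  funext c
  by_cases hc : r c = c
  · have := hfib c
    rwa [Finset.sum_eq_single_of_mem c (by simp [hc])] at this
    intro b hb hbc
    exact hleaf b (by rw [(Finset.mem_filter.1 hb).2]; exact hbc.symm)
  · exact hleaf c hc

end Genericity

section Codimension

variable {m : ℕ} {E : Type*}

theorem IsAffineDependence.eq_zero_of_sum_eq_zero [AddCommGroup E] [Module ℝ E] {ν : Fin m → E}
    (hν : ConditionA (m - 2) ν) {w : Fin m → ℝ} (hw : IsAffineDependence ν w) {I : Finset (Fin m)}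
    (hI : I.Nonempty) (hI' : I ≠ Finset.univ) (hsum : ∑ i ∈ I, w i = 0) : w = 0 := by
  obtain ⟨a, ha⟩ := hI
  obtain ⟨b, hb⟩ : ∃ b, b ∉ I := by simpa [Finset.eq_univ_iff_forall] using hI'
  have hab : a ≠ b := by rintro rfl; exact hb ha
  have hcompl : ∑ i ∈ Iᶜ, w i = 0 := by
    have := Finset.sum_add_sum_compl I w
    rw [hsum, hw.1] at this
    simpa using this
  refine hν.eq_zero_of_fiberwise (fun c => if c ∈ I then a else b) ?_ ?_ w ?_ hw.2
  · intro c
    by_cases hc : c ∈ I <;> simp [hc, ha, hb]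
  · have hset : (Finset.univ.filter fun c => (if c ∈ I then a else b) ≠ c) = {a, b}ᶜ := by
      ext c
      by_cases hc : c ∈ I
      · have : c ≠ b := by rintro rfl; exact hb hc
        simp [hc, this, eq_comm]
      · have : c ≠ a := by rintro rfl; exact hc ha
        simp [hc, this, eq_comm]
    rw [Fintype.card_subtype, hset, Finset.card_compl, Finset.card_pair hab, Fintype.card_fin]
  · intro i
    by_cases hia : i = a
    · subst hia
      rw [← hsum]
      refine Finset.sum_congr ?_ fun _ _ => rfl
      ext c
      by_cases hc : c ∈ I <;> simp [hc, hab.symm]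
    · by_cases hib : i = b
      · subst hib
        rw [← hcompl]
        refine Finset.sum_congr ?_ fun _ _ => rfl
        ext c
        by_cases hc : c ∈ I <;> simp [hc, hab]
      · rw [Finset.filter_false_of_mem, Finset.sum_empty]
        intro c _
        by_cases hc : c ∈ I <;> simp [hc, Ne.symm hia, Ne.symm hib]

theorem IsAffineDependence.eq_zero [NeZero m] [AddCommGroup E] [Module ℝ E] {ν : Fin m → E}
    (hν : ConditionA (m - 1) ν) {w : Fin m → ℝ} (hw : IsAffineDependence ν w) : w = 0 := by
  refine hν.eq_zero_of_fiberwise (fun _ => 0) (fun _ => rfl) ?_ w ?_ hw.2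
  · have hset : (Finset.univ.filter fun c : Fin m => 0 ≠ c) = {0}ᶜ := by
      ext c
      simp [eq_comm]
    rw [Fintype.card_subtype, hset, Finset.card_compl, Finset.card_singleton, Fintype.card_fin]
  · intro i
    by_cases hi : 0 = i
    · simp [hi, hw.1]
    · simp [hi]

variable [NormedAddCommGroup E] [InnerProductSpace ℝ E]

/-- The points `μ` have, up to scaling, the single affine dependence `v`, and the lifts of `μ` to
the paraboloid lie strictly below it. -/
structure HasNegativeCircuit (μ : Fin m → E) (v : Fin m → ℝ) : Prop where
  isAffineDependence : IsAffineDependence μ v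
  eq_smul : ∀ w, IsAffineDependence μ w → ∃ a : ℝ, w = a • v
  sum_neg : ∑ i, v i * ‖μ i‖ ^ 2 < 0

theorem isAffineDependence_lift_iff {μ : Fin m → E} {w : Fin m → ℝ} :
    IsAffineDependence (fun j => (μ j, ‖μ j‖ ^ 2) : Fin m → E × ℝ) w ↔
      IsAffineDependence μ w ∧ ∑ i, w i * ‖μ i‖ ^ 2 = 0 := by
  simp [IsAffineDependence, Prod.ext_iff, Prod.fst_sum, Prod.snd_sum, and_assoc]

theorem HasNegativeCircuit.generic (hm : 2 ≤ m) {μ : Fin m → EuclideanSpace ℝ (Fin (m - 2))}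
    {v : Fin m → ℝ} (h : HasNegativeCircuit μ v)
    (hv : ∀ I : Finset (Fin m), I.Nonempty → I ≠ Finset.univ → ∑ i ∈ I, v i ≠ 0) :
    Generic μ := by
  classical
  refine ⟨conditionA_of_forall_eq_zero fun e c hc => ?_,
    conditionA_of_forall_eq_zero fun e c hc => ?_⟩
  · obtain ⟨s, hs⟩ := h.eq_smul _ hc
    have : Nonempty (Fin m) := ⟨⟨0, by omega⟩⟩
    obtain ⟨a, b, hab⟩ := exists_not_reachable_of_card_lt e (by simp; omega)
    set G := SimpleGraph.fromEdgeSet (Set.range fun k => s((e k).1, (e k).2)) with hG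
    have h0 := sum_filter_sub_smul_eq_zero e c (fun i => G.Reachable a i) (by
      intro k _
      by_cases hk : (e k).1 = (e k).2
      · rw [hk]
      · have hadj : G.Adj (e k).1 (e k).2 := by
          rw [hG, SimpleGraph.fromEdgeSet_adj]
          exact ⟨⟨k, rfl⟩, hk⟩
        exact ⟨fun h => h.trans hadj.reachable, fun h => h.trans hadj.symm.reachable⟩)
    rw [hs] at h0 ⊢
    simp only [Pi.smul_apply, smul_eq_mul, ← Finset.mul_sum] at h0
    rcases mul_eq_zero.1 h0 with h0 | h0
    · rw [h0, zero_smul]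
    · refine absurd h0 (hv _ ⟨a, by simp⟩ fun hu => hab ?_)
      have := Finset.mem_univ b
      rw [← hu] at this
      exact (Finset.mem_filter.1 this).2
  · rw [isAffineDependence_lift_iff] at hc
    obtain ⟨s, hs⟩ := h.eq_smul _ hc.1
    have h0 := hc.2
    rw [hs] at h0 ⊢
    simp only [Pi.smul_apply, smul_eq_mul, mul_assoc, ← Finset.mul_sum] at h0
    rw [(mul_eq_zero.1 h0).resolve_right h.sum_neg.ne, zero_smul]

theorem Generic.exists_hasNegativeCircuit (hm : 3 ≤ m)
    {μ : Fin m → EuclideanSpace ℝ (Fin (m - 2))} (hμ : Generic μ) :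
    ∃ v ∈ genericDirections m, HasNegativeCircuit μ v := by
  have : NeZero m := ⟨by omega⟩
  let T : (Fin m → ℝ) →ₗ[ℝ] EuclideanSpace ℝ (Fin (m - 2)) × ℝ :=
    (Fintype.linearCombination ℝ μ).prod (Fintype.linearCombination ℝ fun _ => (1 : ℝ))
  have hT : ∀ w, T w = 0 ↔ IsAffineDependence μ w := by
    intro w
    simp [T, Fintype.linearCombination_apply, IsAffineDependence, Prod.ext_iff, and_comm]
  obtain ⟨u, hu, hu0⟩ : ∃ u, IsAffineDependence μ u ∧ u ≠ 0 := by
    have : T.ker ≠ ⊥ := LinearMap.ker_ne_bot_of_finrank_lt (by simp; omega)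
    obtain ⟨u, hu, hu0⟩ := Submodule.exists_mem_ne_zero_of_ne_bot this
    exact ⟨u, (hT u).1 hu, hu0⟩
  have hsub : ∀ I : Finset (Fin m), I.Nonempty → I ≠ Finset.univ → ∑ i ∈ I, u i ≠ 0 :=
    fun I h1 h2 h3 => hu0 (hu.eq_zero_of_sum_eq_zero hμ.1 h1 h2 h3)
  have hlift : ∑ i, u i * ‖μ i‖ ^ 2 ≠ 0 :=
    fun h => hu0 (IsAffineDependence.eq_zero hμ.2 (isAffineDependence_lift_iff.2 ⟨hu, h⟩))
  obtain ⟨s, hs0, hsnorm, hsneg⟩ : ∃ s : ℝ, s ≠ 0 ∧ ‖WithLp.toLp 2 (s • u)‖ = 1 ∧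
      s * ∑ i, u i * ‖μ i‖ ^ 2 < 0 := by
    have hn : 0 < ‖WithLp.toLp 2 u‖ := by simpa using hu0
    rcases lt_or_gt_of_ne hlift with h | h
    · refine ⟨‖WithLp.toLp 2 u‖⁻¹, by positivity, ?_, mul_neg_of_pos_of_neg (by positivity) h⟩
      rw [WithLp.toLp_smul, norm_smul, norm_inv, norm_norm, inv_mul_cancel₀ hn.ne']
    · refine ⟨-‖WithLp.toLp 2 u‖⁻¹, by simpa using hu0, ?_,
        mul_neg_of_neg_of_pos (by simpa using hu0) h⟩
      rw [WithLp.toLp_smul, norm_smul, norm_neg, norm_inv, norm_norm, inv_mul_cancel₀ hn.ne']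
  have h0 : ({0} : Finset (Fin m)) ≠ Finset.univ := by
    intro h
    have := congrArg Finset.card h
    simp at this
    omega
  have hu0' : u 0 ≠ 0 := by simpa using hsub {0} (by simp) h0
  refine ⟨WithLp.toLp 2 (s • u), ⟨?_, hsnorm, ?_⟩, ⟨?_, ?_⟩, ?_, ?_⟩
  · simp [← Finset.mul_sum, hu.1]
  · intro I h1 h2
    simpa [← Finset.mul_sum, hs0] using hsub I h1 h2
  · simp [← Finset.mul_sum, hu.1]
  · simp [mul_smul, ← Finset.smul_sum, hu.2]
  · intro w hw
    refine ⟨w 0 / u 0 / s, ?_⟩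
    have hdep : IsAffineDependence μ (w - (w 0 / u 0) • u) := by
      rw [← hT] at hw hu ⊢
      rw [map_sub, map_smul, hw, hu, smul_zero, sub_zero]
    have := hdep.eq_zero_of_sum_eq_zero hμ.1 (I := {0}) (by simp) h0 (by simp [hu0'])
    rw [sub_eq_zero] at this
    rw [WithLp.ofLp_toLp, smul_smul, div_mul_cancel₀ _ hs0, ← this]
  · simpa [mul_assoc, ← Finset.mul_sum] using hsneg

/-- A circuit with a single negative coefficient lies above the paraboloid. -/
theorem HasNegativeCircuit.exists_neg {μ : Fin m → E} {v : Fin m → ℝ}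
    (h : HasNegativeCircuit μ v) (j : Fin m) : ∃ i ≠ j, v i < 0 := by
  by_contra! hcon
  refine h.sum_neg.not_ge ?_
  have key : ∑ i, v i * ‖μ i‖ ^ 2 = ∑ i, v i * ‖μ i - μ j‖ ^ 2 := by
    have h1 : ∀ i, v i * ‖μ i - μ j‖ ^ 2 =
        v i * ‖μ i‖ ^ 2 - 2 * inner ℝ (v i • μ i) (μ j) + v i * ‖μ j‖ ^ 2 := by
      intro i
      rw [norm_sub_sq_real, real_inner_smul_left]
      ring
    simp only [h1, Finset.sum_add_distrib, Finset.sum_sub_distrib, ← Finset.mul_sum,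
      ← Finset.sum_mul, ← sum_inner, h.isAffineDependence.1, h.isAffineDependence.2]
    simp
  rw [key]
  refine Finset.sum_nonneg fun i _ => ?_
  by_cases hij : i = j
  · simp [hij]
  · exact mul_nonneg (hcon i hij) (by positivity)

/-- Points in `ℝ^(m-2)` realising a given direction with at least two negative entries. -/
theorem exists_hasNegativeCircuit {v : Fin m → ℝ} (hm : 3 ≤ m) (hsum : ∑ i, v i = 0) {a b : Fin m}
    (hab : a ≠ b) (ha : v a < 0) (hb : v b < 0) :
    ∃ μ : Fin m → EuclideanSpace ℝ (Fin (m - 2)), HasNegativeCircuit μ v := by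
  obtain ⟨d, hd⟩ : ∃ d, d ∉ ({a, b} : Finset (Fin m)) := by
    by_contra! hcon
    have := Finset.card_le_card (Finset.subset_univ ({a, b} : Finset (Fin m)))
    rw [Finset.eq_univ_iff_forall.2 hcon, Finset.card_univ, Fintype.card_fin] at this
    have h2 := Finset.card_pair hab
    rw [Finset.eq_univ_iff_forall.2 hcon, Finset.card_univ, Fintype.card_fin] at h2
    omega
  simp only [Finset.mem_insert, Finset.mem_singleton, not_or] at hd
  obtain ⟨f⟩ : Nonempty (Fin (m - 2) ≃ {c // c ∉ ({a, d} : Finset (Fin m))}) := by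
    refine ⟨(Fintype.equivFinOfCardEq ?_).symm⟩
    rw [Fintype.card_subtype, Finset.filter_not, Finset.filter_mem_eq_inter, Finset.univ_inter,
      ← Finset.compl_eq_univ_sdiff, Finset.card_compl, Finset.card_pair (Ne.symm hd.1),
      Fintype.card_fin]
  have hfa : ∀ k, (f k).1 ≠ a := fun k h => (f k).2 (by simp [h])
  set q : Fin (m - 2) → ℝ := fun k => v (f k) + v (f k) ^ 2 / v a with hq
  set kb : Fin (m - 2) := f.symm ⟨b, by simp [hab.symm, Ne.symm hd.2]⟩ with hkb
  have hqb : q kb < 0 := by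
    have : v b ^ 2 / v a < 0 := div_neg_of_pos_of_neg (by have := hb.ne; positivity) ha
    simp only [hq, hkb, Equiv.apply_symm_apply]
    linarith
  obtain ⟨t, ht0, ht⟩ : ∃ t : ℝ, t ≠ 0 ∧ (t ^ 2 - 1) * q kb + ∑ k, q k < 0 := by
    have hu : 0 < (|∑ k, q k| + 1) / -q kb := div_pos (by positivity) (by linarith)
    refine ⟨√(1 + (|∑ k, q k| + 1) / -q kb), by positivity, ?_⟩
    rw [Real.sq_sqrt (by positivity), add_sub_cancel_left, div_neg, neg_mul,
      div_mul_cancel₀ _ hqb.ne]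
    linarith [le_abs_self (∑ k, q k)]
  set s : Fin (m - 2) → ℝ := fun k => if k = kb then t else 1 with hs
  have hs0 : ∀ k, s k ≠ 0 := by
    intro k
    by_cases hk : k = kb <;> simp [hs, hk, ht0]
  set μ : Fin m → EuclideanSpace ℝ (Fin (m - 2)) := fun i => WithLp.toLp 2 fun k =>
    s k * ((if i = f k then 1 else 0) - if i = a then v (f k) / v a else 0) with hμ
  have hcoord : ∀ (w : Fin m → ℝ) k,
      (∑ i, w i • μ i) k = s k * (w (f k) - w a * (v (f k) / v a)) := by
    intro w k
    simp only [hμ, WithLp.ofLp_sum, WithLp.ofLp_smul, Finset.sum_apply, Pi.smul_apply, smul_eq_mul,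
      mul_left_comm _ (s k), mul_sub, Finset.sum_sub_distrib, mul_ite, mul_one, mul_zero,
      Finset.sum_ite_eq', Finset.mem_univ, if_true]
    ring
  refine ⟨μ, ⟨hsum, ?_⟩, ?_, ?_⟩
  · ext k
    rw [hcoord, mul_div_cancel₀ _ ha.ne]
    simp
  · intro w hw
    have hf : ∀ i, i ≠ d → w i = w a / v a * v i := by
      intro i hid
      by_cases hia : i = a
      · rw [hia, div_mul_cancel₀ _ ha.ne]
      · have := hcoord w (f.symm ⟨i, by simp [hia, hid]⟩)
        rw [hw.2] at this
        simp only [PiLp.zero_apply, Equiv.apply_symm_apply, zero_eq_mul, hs0, false_or] at this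
        rw [sub_eq_zero.1 this]
        ring
    refine ⟨w a / v a, funext fun i => ?_⟩
    by_cases hid : i = d
    · have h1 : ∑ i, (w i - w a / v a * v i) = 0 := by
        rw [Finset.sum_sub_distrib, ← Finset.mul_sum, hw.1, hsum, mul_zero, sub_zero]
      rw [Finset.sum_eq_single d (fun i _ hi => by rw [hf i hi, sub_self]) (by simp)] at h1
      rw [hid]
      exact sub_eq_zero.1 h1
    · exact hf i hid
  · have hterm : ∀ k, ∑ i, v i * (μ i k) ^ 2 = s k ^ 2 * q k := by
      intro k
      have hsq : ∀ i, v i * (μ i k) ^ 2 = s k ^ 2 * ((if i = f k then v i else 0) +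
          if i = a then v i * (v (f k) / v a) ^ 2 else 0) := by
        intro i
        by_cases h1 : i = f k
        · have h2 : i ≠ a := h1 ▸ hfa k
          simp only [hμ, if_pos h1, if_neg h2]
          ring
        · by_cases h2 : i = a
          · simp only [hμ, if_neg h1, if_pos h2]
            ring
          · simp [hμ, h1, h2]
      simp only [hsq, ← Finset.mul_sum, Finset.sum_add_distrib, Finset.sum_ite_eq',
        Finset.mem_univ, if_true, hq]
      have := ha.ne
      field_simp
    have hs2 : ∀ k, s k ^ 2 * q k = (if k = kb then (t ^ 2 - 1) * q k else 0) + q k := by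
      intro k
      by_cases hk : k = kb
      · simp only [hs, if_pos hk]
        ring
      · simp [hs, hk]
    simp only [EuclideanSpace.real_norm_sq_eq, Finset.mul_sum]
    rw [Finset.sum_comm]
    simp only [hterm, hs2, Finset.sum_add_distrib, Finset.sum_ite_eq', Finset.mem_univ, if_true]
    exact ht

end Codimension

section Patterns

variable {m : ℕ}

/-- A ranking belongs to the pattern of `v` iff some vector in its chamber, not necessarily
centred, has positive pairing with `v`. -/
theorem mem_rankingPattern_iff {v : EuclideanSpace ℝ (Fin m)} (hv : ∑ i, v i = 0)
    {σ : Equiv.Perm (Fin m)} :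
    σ ∈ rankingPattern v ↔
      ∃ x : Fin m → ℝ, (∀ k l, k < l → x (σ l) < x (σ k)) ∧ 0 < ∑ i, v i * x i := by
  constructor
  · rintro ⟨x, ⟨-, h1⟩, -, h2⟩
    exact ⟨x, h2, h1 ▸ one_pos⟩
  · rintro ⟨x, hx, hpos⟩
    have hm : (m : ℝ) ≠ 0 := by
      rintro h
      have : m = 0 := by exact_mod_cast h
      subst this
      simp at hpos
    set S := ∑ i, v i * x i with hS
    set t := (∑ i, x i) / m with ht
    have h0 : ∑ i, S⁻¹ * (x i - t) = 0 := by
      rw [← Finset.mul_sum, Finset.sum_sub_distrib]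
      simp [ht, mul_div_cancel₀ _ hm]
    refine ⟨WithLp.toLp 2 fun i => S⁻¹ * (x i - t), ⟨h0, ?_⟩, h0, fun k l hkl => ?_⟩
    · have : ∀ i, v i * (S⁻¹ * (x i - t)) = S⁻¹ * (v i * x i) - v i * (S⁻¹ * t) := by
        intro i
        ring
      simp only [this, Finset.sum_sub_distrib, ← Finset.mul_sum, ← Finset.sum_mul, hv, ← hS]
      rw [inv_mul_cancel₀ hpos.ne', zero_mul, sub_zero]
    · exact mul_lt_mul_of_pos_left (sub_lt_sub_right (hx k l hkl) t) (inv_pos.2 hpos)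

theorem HasNegativeCircuit.exists_inner_add {E : Type*} [NormedAddCommGroup E]
    [InnerProductSpace ℝ E] [FiniteDimensional ℝ E] {μ : Fin m → E} {v : Fin m → ℝ}
    (h : HasNegativeCircuit μ v) {x : Fin m → ℝ} (hx : ∑ i, v i * x i = 0) :
    ∃ (y : E) (t : ℝ), ∀ i, x i = inner ℝ y (μ i) + t := by
  let T : (Fin m → ℝ) →ₗ[ℝ] E × ℝ :=
    (Fintype.linearCombination ℝ μ).prod (Fintype.linearCombination ℝ fun _ => (1 : ℝ))
  have hmem : Fintype.linearCombination ℝ x ∈ T.dualMap.range := by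
    rw [LinearMap.range_dualMap_eq_dualAnnihilator_ker, Submodule.mem_dualAnnihilator]
    intro w hw
    have hw' : IsAffineDependence μ w := by
      simpa [T, Fintype.linearCombination_apply, IsAffineDependence, Prod.ext_iff, and_comm]
        using hw
    obtain ⟨a, rfl⟩ := h.eq_smul w hw'
    simp [Fintype.linearCombination_apply, hx]
  obtain ⟨φ, hφ⟩ := hmem
  refine ⟨(InnerProductSpace.toDual ℝ E).symm
    (LinearMap.toContinuousLinearMap (φ ∘ₗ LinearMap.inl ℝ E ℝ)), φ (0, 1), fun i => ?_⟩
  have := LinearMap.congr_fun hφ (Pi.single i 1)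
  simp only [LinearMap.dualMap_apply, T, LinearMap.prod_apply, Function.prod,
    Fintype.linearCombination_apply_single, one_smul, smul_eq_mul, one_mul] at this
  rw [InnerProductSpace.toDual_symm_apply]
  simp only [LinearMap.coe_toContinuousLinearMap', LinearMap.comp_apply, LinearMap.inl_apply]
  rw [← this, ← map_add]
  simp

theorem HasNegativeCircuit.rankingPatternUF_eq {n : ℕ} {μ : Fin m → EuclideanSpace ℝ (Fin n)}
    {v : EuclideanSpace ℝ (Fin m)} (h : HasNegativeCircuit μ v) :
    rankingPatternUF μ = rankingPattern v := by
  have hlt : ∀ (y : EuclideanSpace ℝ (Fin n)) (i j : Fin m), ‖y - μ i‖ < ‖y - μ j‖ ↔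
      2 * inner ℝ y (μ j) - ‖μ j‖ ^ 2 < 2 * inner ℝ y (μ i) - ‖μ i‖ ^ 2 := by
    intro y i j
    rw [← pow_lt_pow_iff_left₀ (norm_nonneg _) (norm_nonneg _) two_ne_zero, norm_sub_sq_real,
      norm_sub_sq_real]
    constructor <;> intro h <;> linarith
  ext σ
  rw [mem_rankingPattern_iff h.isAffineDependence.1]
  constructor
  · rintro ⟨y, hy⟩
    refine ⟨fun i => 2 * inner ℝ y (μ i) - ‖μ i‖ ^ 2, fun k l hkl => (hlt _ _ _).1 (hy k l hkl), ?_⟩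
    have h1 : ∀ i, v i * (2 * inner ℝ y (μ i) - ‖μ i‖ ^ 2) =
        2 * inner ℝ y (v i • μ i) - v i * ‖μ i‖ ^ 2 := by
      intro i
      rw [real_inner_smul_right]
      ring
    simp only [h1, Finset.sum_sub_distrib, ← Finset.mul_sum, ← inner_sum, h.isAffineDependence.2]
    simpa using h.sum_neg
  · rintro ⟨x, hx, hpos⟩
    set s := -(∑ i, v i * ‖μ i‖ ^ 2) / ∑ i, v i * x i with hs
    have hs0 : 0 < s := div_pos (neg_pos.2 h.sum_neg) hpos
    obtain ⟨y, t, hyt⟩ := h.exists_inner_add (x := fun i => s * x i + ‖μ i‖ ^ 2) (by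
      simp only [mul_add, Finset.sum_add_distrib, mul_left_comm _ s, ← Finset.mul_sum]
      rw [hs, div_mul_cancel₀ _ hpos.ne', neg_add_cancel])
    refine ⟨(2⁻¹ : ℝ) • y, fun k l hkl => (hlt _ _ _).2 ?_⟩
    have h1 : ∀ i, 2 * inner ℝ ((2⁻¹ : ℝ) • y) (μ i) - ‖μ i‖ ^ 2 = s * x i - t := by
      intro i
      rw [real_inner_smul_left]
      linarith [hyt i]
    rw [h1, h1]
    exact sub_lt_sub_right (mul_lt_mul_of_pos_left (hx k l hkl) hs0) t

theorem mem_rankingPatternsUF_iff (hm : 3 ≤ m) {R : Set (Equiv.Perm (Fin m))} :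
    R ∈ rankingPatternsUF m ↔
      ∃ v ∈ genericDirections m, (∀ j, ∃ i ≠ j, v i < 0) ∧ R = rankingPattern v := by
  constructor
  · rintro ⟨μ, hμ, rfl⟩
    obtain ⟨v, hv, h⟩ := hμ.exists_hasNegativeCircuit hm
    exact ⟨v, hv, h.exists_neg, h.rankingPatternUF_eq⟩
  · rintro ⟨v, hv, hneg, rfl⟩
    obtain ⟨a, -, ha⟩ := hneg ⟨0, by omega⟩
    obtain ⟨b, hba, hb⟩ := hneg a
    obtain ⟨μ, hμ⟩ := exists_hasNegativeCircuit hm hv.1 hba.symm ha hb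
    exact ⟨μ, hμ.generic (by omega) hv.2.2, hμ.rankingPatternUF_eq.symm⟩

theorem rankingPattern_eq_of_nonneg [NeZero m] (hm : 2 ≤ m) {v : EuclideanSpace ℝ (Fin m)}
    (hv : v ∈ genericDirections m) {j : Fin m} (hj : ∀ i ≠ j, 0 ≤ v i) :
    rankingPattern v = {σ | σ 0 ≠ j} := by
  have hpos : ∀ i ≠ j, 0 < v i := by
    intro i hij
    refine (hj i hij).lt_of_ne' ?_
    simpa using hv.2.2 {i} (by simp) (by
      intro h
      have := congrArg Finset.card h
      simp at this
      omega)
  ext σ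
  rw [mem_rankingPattern_iff hv.1, Set.mem_ofPred_eq]
  constructor
  · rintro ⟨x, hx, hsum⟩ h0
    refine hsum.not_ge ?_
    have h1 : ∑ i, v i * x i = ∑ i, v i * (x i - x j) := by
      simp only [mul_sub, Finset.sum_sub_distrib, ← Finset.sum_mul, hv.1]
      simp
    rw [h1]
    refine Finset.sum_nonpos fun i _ => ?_
    by_cases hij : i = j
    · simp [hij]
    · refine mul_nonpos_of_nonneg_of_nonpos (hj i hij) (sub_nonpos.2 ?_)
      obtain ⟨l, rfl⟩ := σ.surjective i
      rw [← h0]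
      refine (hx 0 l ((Fin.zero_le l).lt_of_ne' ?_)).le
      rintro rfl
      exact hij h0
  · intro h0
    have hv0 := hpos _ h0
    set B := ∑ i, v i * -((σ.symm i : ℕ) : ℝ) with hB
    set M := (|B| + 1) / v (σ 0) with hM
    have hM0 : 0 < M := div_pos (by positivity) hv0
    refine ⟨fun i => -((σ.symm i : ℕ) : ℝ) + if i = σ 0 then M else 0, fun k l hkl => ?_, ?_⟩
    · have hl : l ≠ 0 := by rintro rfl; exact (Fin.not_lt_zero k hkl).elim
      have hkl' : ((k : ℕ) : ℝ) < (l : ℕ) := by exact_mod_cast hkl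
      have hk : (0 : ℝ) ≤ if k = 0 then M else 0 := by split_ifs <;> linarith
      simp only [Equiv.symm_apply_apply, EmbeddingLike.apply_eq_iff_eq, if_neg hl]
      linarith
    · simp only [mul_add, Finset.sum_add_distrib, mul_ite, mul_zero, Finset.sum_ite_eq',
        Finset.mem_univ, if_true, ← hB]
      rw [hM, mul_div_cancel₀ _ hv0.ne']
      linarith [neg_abs_le B]

theorem rankingPattern_ne_of_exists_neg [NeZero m] {v : EuclideanSpace ℝ (Fin m)}
    (hv : ∑ i, v i = 0) (hneg : ∀ j, ∃ i ≠ j, v i < 0) (j : Fin m) :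
    rankingPattern v ≠ {σ | σ 0 ≠ j} := by
  obtain ⟨a, haj, ha⟩ := hneg j
  obtain ⟨b, -, hb⟩ := Finset.exists_min_image Finset.univ v ⟨a, Finset.mem_univ a⟩
  set g : Fin m → ℝ := Function.update v a (v b - 1) with hg
  have hga : ∀ i ≠ a, g a < g i := by
    intro i hi
    rw [hg, Function.update_self, Function.update_of_ne hi]
    linarith [hb i (Finset.mem_univ i)]
  set σ := Tuple.sort g with hσ
  have hmono : Monotone (g ∘ σ) := Tuple.monotone_sort g
  have h0 : σ 0 = a := by
    by_contra hne
    have := hmono (Fin.zero_le (σ.symm a))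
    simp only [Function.comp_apply, Equiv.apply_symm_apply] at this
    exact this.not_gt (hga _ hne)
  intro heq
  have hmem : σ ∈ rankingPattern v := by
    rw [heq, Set.mem_ofPred_eq, h0]
    exact haj
  obtain ⟨x, hx, hpos⟩ := (mem_rankingPattern_iff hv).1 hmem
  have hneg_before : ∀ p n, v n < 0 → 0 ≤ v p → x p ≤ x n := by
    intro p n hn hp
    obtain ⟨k, rfl⟩ := σ.surjective n
    obtain ⟨l, rfl⟩ := σ.surjective p
    refine (hx k l (lt_of_not_ge fun hlk => ?_)).le
    have h1 := hmono hlk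
    have hpa : σ l ≠ a := by intro h; rw [h] at hp; linarith
    simp only [Function.comp_apply] at h1
    by_cases hna : σ k = a
    · rw [hna] at h1
      exact h1.not_gt (hga _ hpa)
    · rw [hg, Function.update_of_ne hpa, Function.update_of_ne hna] at h1
      linarith
  obtain ⟨n, hn, hnmin⟩ := Finset.exists_min_image (Finset.univ.filter fun i => v i < 0) x
    ⟨a, by simpa using ha⟩
  refine hpos.not_ge ?_
  have h1 : ∑ i, v i * x i = ∑ i, v i * (x i - x n) := by
    simp only [mul_sub, Finset.sum_sub_distrib, ← Finset.sum_mul, hv]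
    simp
  rw [h1]
  refine Finset.sum_nonpos fun i _ => ?_
  rcases lt_or_ge (v i) 0 with hi | hi
  · exact mul_nonpos_of_nonpos_of_nonneg hi.le (sub_nonneg.2 (hnmin i (by simpa using hi)))
  · exact mul_nonpos_of_nonneg_of_nonpos hi
      (sub_nonpos.2 (hneg_before i n (by simpa using hn) hi))

theorem patternEquiv_equivalence : Equivalence (patternEquiv (m := m)) where
  refl R := ⟨1, by simp⟩
  symm := by
    rintro _ R ⟨σ, rfl⟩
    exact ⟨σ⁻¹, by rw [Set.image_image]; simp⟩
  trans := by
    rintro _ _ R ⟨σ, rfl⟩ ⟨τ, rfl⟩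
    exact ⟨σ * τ, by rw [Set.image_image]; simp only [mul_assoc]⟩

theorem patternEquiv_setOf_apply_zero_ne_iff [NeZero m] {R : Set (Equiv.Perm (Fin m))} {j : Fin m} :
    patternEquiv R {σ | σ 0 ≠ j} ↔ ∃ i, R = {σ | σ 0 ≠ i} := by
  have key : ∀ π : Equiv.Perm (Fin m),
      (fun τ => π * τ) '' {σ | σ 0 ≠ j} = {σ : Equiv.Perm (Fin m) | σ 0 ≠ π j} := by
    intro π
    ext σ
    constructor
    · rintro ⟨τ, hτ, rfl⟩
      simpa using hτ
    · intro h
      refine ⟨π⁻¹ * σ, fun h' => h ?_, by simp⟩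
      rw [← h']
      simp
  constructor
  · rintro ⟨π, rfl⟩
    exact ⟨π j, key π⟩
  · rintro ⟨i, rfl⟩
    exact ⟨Equiv.swap j i, by rw [key, Equiv.swap_apply_left]⟩

theorem setOf_apply_zero_ne_mem_rankingPatternsSlices [NeZero m] (hm : 2 ≤ m) :
    {σ : Equiv.Perm (Fin m) | σ 0 ≠ 0} ∈ rankingPatternsSlices m := by
  set u : Fin m → ℝ := fun i => 1 - if i = 0 then (m : ℝ) else 0 with hu
  have hsub : ∀ I : Finset (Fin m), I.Nonempty → I ≠ Finset.univ → ∑ i ∈ I, u i ≠ 0 := by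
    intro I hI hI'
    have h1 : ∑ i ∈ I, u i = (I.card : ℝ) - if 0 ∈ I then (m : ℝ) else 0 := by
      simp [hu, Finset.sum_sub_distrib, Finset.sum_ite_eq']
    have h2 : I.card < m := by
      simpa using Finset.card_lt_card (Finset.ssubset_univ_iff.2 hI')
    have h3 : (I.card : ℝ) < m := by exact_mod_cast h2
    have h4 : (0 : ℝ) < I.card := by exact_mod_cast hI.card_pos
    rw [h1]
    split_ifs
    · exact (sub_neg.2 h3).ne
    · simpa using h4.ne'
  have hu0 : 0 < ‖WithLp.toLp 2 u‖ := by
    rw [norm_pos_iff, ne_eq, WithLp.toLp_eq_zero]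
    intro h
    refine hsub {0} (by simp) ?_ (by simp [h])
    intro h
    have := congrArg Finset.card h
    simp at this
    omega
  have hv : WithLp.toLp 2 (‖WithLp.toLp 2 u‖⁻¹ • u) ∈ genericDirections m := by
    refine ⟨?_, ?_, fun I h1 h2 => ?_⟩
    · simp [← Finset.mul_sum, hu, Finset.sum_sub_distrib]
    · rw [WithLp.toLp_smul, norm_smul, norm_inv, norm_norm, inv_mul_cancel₀ hu0.ne']
    · simp only [Pi.smul_apply, smul_eq_mul, ← Finset.mul_sum]
      exact mul_ne_zero (inv_ne_zero hu0.ne') (hsub I h1 h2)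
  refine ⟨_, hv, (rankingPattern_eq_of_nonneg hm hv fun i hi => ?_).symm⟩
  simp [hu, hi]

end Patterns

/-- Proposition 6.1: the number of inequivalent ranking patterns of unfolding
models of codimension one equals the number of inequivalent ranking patterns of
generic braid slices minus one. -/
theorem card_inequiv_rankingPatternsUF {m : ℕ} (hm : 3 ≤ m) :
    Nat.card (Quot fun (R R' : rankingPatternsUF m) => patternEquiv R.1 R'.1) =
      Nat.card (Quot fun (R R' : rankingPatternsSlices m) =>
        patternEquiv R.1 R'.1) - 1 := by
  have : NeZero m := ⟨by omega⟩
  have hsub : ∀ R ∈ rankingPatternsUF m, R ∈ rankingPatternsSlices m := by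
    intro R hR
    obtain ⟨v, hv, -, rfl⟩ := (mem_rankingPatternsUF_iff hm).1 hR
    exact ⟨v, hv, rfl⟩
  have hsep : ∀ R ∈ rankingPatternsUF m, ¬ patternEquiv R {σ | σ 0 ≠ 0} := by
    intro R hR h
    obtain ⟨v, hv, hneg, rfl⟩ := (mem_rankingPatternsUF_iff hm).1 hR
    obtain ⟨j, hj⟩ := patternEquiv_setOf_apply_zero_ne_iff.1 h
    exact rankingPattern_ne_of_exists_neg hv.1 hneg j hj
  have hexact : ∀ R R' : rankingPatternsSlices m,
      Quot.mk (fun (R R' : rankingPatternsSlices m) => patternEquiv R.1 R'.1) R = Quot.mk _ R' →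
      patternEquiv R.1 R'.1 := fun R R' h =>
    (patternEquiv_equivalence.comap Subtype.val).eqvGen_iff.1 (Quot.eqvGen_exact h)
  let f : Option (Quot fun (R R' : rankingPatternsUF m) => patternEquiv R.1 R'.1) →
      Quot fun (R R' : rankingPatternsSlices m) => patternEquiv R.1 R'.1 := fun o =>
    o.elim (Quot.mk _ ⟨_, setOf_apply_zero_ne_mem_rankingPatternsSlices (by omega)⟩)
      (Quot.map (fun R => ⟨R.1, hsub R.1 R.2⟩) fun _ _ h => h)
  have hf : Function.Bijective f := by
    constructor
    · rintro (_ | ⟨⟨R⟩⟩) (_ | ⟨⟨R'⟩⟩) h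
      · rfl
      · exact absurd (patternEquiv_equivalence.symm (hexact _ _ h)) (hsep _ R'.2)
      · exact absurd (hexact _ _ h) (hsep _ R.2)
      · exact congrArg some (Quot.sound (hexact _ _ h))
    · rintro ⟨⟨_, v, hv, rfl⟩⟩
      by_cases hneg : ∀ j, ∃ i ≠ j, v i < 0
      · exact ⟨some (Quot.mk _ ⟨_, (mem_rankingPatternsUF_iff hm).2 ⟨v, hv, hneg, rfl⟩⟩), rfl⟩
      · push Not at hneg
        obtain ⟨j, hj⟩ := hneg
        exact ⟨none, Quot.sound (patternEquiv_equivalence.symm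
          (patternEquiv_setOf_apply_zero_ne_iff.2
            ⟨j, rankingPattern_eq_of_nonneg (by omega) hv hj⟩))⟩
  rw [← Nat.card_eq_of_bijective f hf, Finite.card_option, Nat.add_sub_cancel]
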